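/- arXiv:1003.4317 — 5 statements merged into one kernel-verified Lean document; each statement's English description precedes it below -/
import Mathlib

section
/- Let n be a natural number, let σ be a permutation of Fin (n+1), let i : Fin (n+1), and set j := σ⁻¹ i. Then there exists a unique permutation τ of Fin n such that σ (j.succAbove k) = i.succAbove (τ k) for every k : Fin n, and moreover sign τ = (-1)^{(i : ℕ) + (j : ℕ)} · sign σ. -/
open Equiv Equiv.Perm in
/-- A permutation `σ` sending `j` to `i` restricts to `τ` away from `j` and `i` if and only if it
is, up to the cycles moving `j` and `i` to `0`, the extension of `τ` fixing `0`. -/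
theorem Equiv.Perm.forall_apply_succAbove_iff {n : ℕ} {σ : Perm (Fin (n + 1))}
    {i j : Fin (n + 1)} (hij : σ j = i) (τ : Perm (Fin n)) :
    (∀ k, σ (j.succAbove k) = i.succAbove (τ k)) ↔
      i.cycleRange * σ * j.cycleRange⁻¹ = decomposeFin.symm (0, τ) := by
  refine ⟨fun h ↦ ?_, fun h k ↦ i.cycleRange.injective ?_⟩
  · ext x : 1
    refine Fin.cases ?_ (fun k ↦ ?_) x
    · simp [Perm.inv_def, hij]
    · simp [Perm.inv_def, h]
  · simpa [Perm.inv_def] using Perm.congr_fun h k.succ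

/-- For a permutation `σ` of `Fin (n+1)` and `i : Fin (n+1)`, setting `j := σ⁻¹ i`,
there is a unique permutation `τ` of `Fin n` with
`σ (j.succAbove k) = i.succAbove (τ k)` for all `k : Fin n`; moreover this `τ`
satisfies `sign τ = (-1)^(i + j) * sign σ`. -/
theorem deleted_perm_exists_unique_and_sign (n : ℕ) (σ : Equiv.Perm (Fin (n + 1)))
    (i : Fin (n + 1)) (j : Fin (n + 1)) (hj : j = σ⁻¹ i) :
    (∃! τ : Equiv.Perm (Fin n),
      ∀ k : Fin n, σ (j.succAbove k) = i.succAbove (τ k)) ∧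
    ∀ τ : Equiv.Perm (Fin n),
      (∀ k : Fin n, σ (j.succAbove k) = i.succAbove (τ k)) →
        Equiv.Perm.sign τ = (-1) ^ ((i : ℕ) + (j : ℕ)) * Equiv.Perm.sign σ := by
  have hij : σ j = i := by simp [hj]
  simp only [Equiv.Perm.forall_apply_succAbove_iff hij]
  refine ⟨?_, fun τ hτ ↦ ?_⟩
  · obtain ⟨⟨p, τ⟩, hτ⟩ := Equiv.Perm.decomposeFin.symm.surjective
      (i.cycleRange * σ * j.cycleRange⁻¹)
    obtain rfl : p = 0 := by
      simpa [Equiv.Perm.inv_def, hij] using Equiv.Perm.congr_fun hτ 0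
    refine ⟨τ, hτ.symm, fun τ' hτ' ↦ ?_⟩
    simpa using hτ'.symm.trans hτ.symm
  · have h := congrArg Equiv.Perm.sign hτ
    rw [Equiv.Perm.decomposeFin.symm_sign, if_pos rfl, one_mul] at h
    rw [← h, map_mul, map_mul, Equiv.Perm.sign_inv, Fin.sign_cycleRange, Fin.sign_cycleRange,
      pow_add, mul_right_comm]
end

section
/- Let n ≥ 1. The ℝ-algebra homomorphism μ_n : DualNumber ℝ →ₐ[ℝ] A_n determined by ε ↦ ∏X is well defined and injective, and its range is exactly { q ∈ A_n ∣ ∀ j : Fin n, ε_j q = ε_• q }. -/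
open MvPolynomial

/-- The ideal `(X₀², …, X_{n-1}²)` of `ℝ[X₀, …, X_{n-1}]`. -/
noncomputable def weilIdeal (n : ℕ) : Ideal (MvPolynomial (Fin n) ℝ) :=
  Ideal.span (Set.range fun i : Fin n => (X i : MvPolynomial (Fin n) ℝ) ^ 2)

/-- The Weil algebra `A_n = W_{D^n} = ℝ[X₀, …, X_{n-1}]/(X₀², …, X_{n-1}²)`. -/
noncomputable abbrev WeilA (n : ℕ) : Type :=
  MvPolynomial (Fin n) ℝ ⧸ weilIdeal n

/-- Lifting an assignment of square-zero elements `g : Fin n → B` to an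
`ℝ`-algebra homomorphism `A_n →ₐ[ℝ] B`. -/
noncomputable def WeilA.lift {n : ℕ} {B : Type*} [CommRing B] [Algebra ℝ B]
    (g : Fin n → B) (hg : ∀ i, g i ^ 2 = 0) : WeilA n →ₐ[ℝ] B :=
  Ideal.Quotient.liftₐ (weilIdeal n) (aeval g) (by
    intro a ha
    have h : weilIdeal n ≤ RingHom.ker (aeval g : MvPolynomial (Fin n) ℝ →ₐ[ℝ] B) := by
      rw [weilIdeal, Ideal.span_le]
      rintro p ⟨i, rfl⟩
      simp [RingHom.mem_ker, hg i]
    simpa [RingHom.mem_ker] using h ha)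

/-- The class of `X i` squares to zero in `A_n`. -/
theorem WeilA.mk_X_sq (n : ℕ) (i : Fin n) :
    (Ideal.Quotient.mk (weilIdeal n) (X i)) ^ 2 = 0 := by
  rw [← map_pow, Ideal.Quotient.eq_zero_iff_mem]
  exact Ideal.subset_span ⟨i, rfl⟩

/-- `ε_j : A_n →ₐ[ℝ] A_n`, induced by `X j ↦ 0` and `X k ↦ X k` for `k ≠ j`. -/
noncomputable def epsAt {n : ℕ} (j : Fin n) : WeilA n →ₐ[ℝ] WeilA n :=
  WeilA.lift (fun k => if k = j then 0 else Ideal.Quotient.mk (weilIdeal n) (X k))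
    (by
      intro k
      by_cases h : k = j <;> simp [h, WeilA.mk_X_sq])

/-- `ε_• : A_n →ₐ[ℝ] A_n`, induced by `X i ↦ 0` for all `i`. -/
noncomputable def epsAll {n : ℕ} : WeilA n →ₐ[ℝ] WeilA n :=
  WeilA.lift (fun _ => 0) (by intro k; simp)

theorem mem_weilIdeal_iff {n : ℕ} {p : MvPolynomial (Fin n) ℝ} :
    p ∈ weilIdeal n ↔ ∀ m : Fin n →₀ ℕ, (∀ i, m i ≤ 1) → coeff m p = 0 := by
  have h : weilIdeal n = Ideal.span ((fun s => monomial s (1 : ℝ)) ''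
      Set.range fun i : Fin n => Finsupp.single i 2) := by
    rw [weilIdeal, ← Set.range_comp]
    simp [Function.comp_def, X_pow_eq_monomial]
  rw [h, mem_ideal_span_monomial_image]
  refine forall_congr' fun m => ?_
  simp only [mem_support_iff, Set.exists_range_iff, Finsupp.single_le_iff, ne_eq]
  refine not_imp_comm.trans (imp_congr_left ?_)
  simp

theorem aeval_ite_monomial {n : ℕ} (j : Fin n) (m : Fin n →₀ ℕ) (a : ℝ) :
    aeval (fun k => if k = j then 0 else X k : Fin n → MvPolynomial (Fin n) ℝ) (monomial m a) =
      if m j = 0 then monomial m a else 0 := by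
  rw [aeval_monomial, Finsupp.prod_fintype _ _ (by simp)]
  split_ifs with h
  · rw [monomial_eq, Finsupp.prod_fintype _ _ (by simp)]
    congr 1
    refine Finset.prod_congr rfl fun k _ => ?_
    by_cases hk : k = j
    · simp [hk, h]
    · simp [hk]
  · rw [Finset.prod_eq_zero (Finset.mem_univ j) (by simp [h]), mul_zero]

theorem coeff_aeval_ite {n : ℕ} (j : Fin n) (m : Fin n →₀ ℕ) (p : MvPolynomial (Fin n) ℝ) :
    coeff m (aeval (fun k => if k = j then 0 else X k : Fin n → MvPolynomial (Fin n) ℝ) p) =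
      if m j = 0 then coeff m p else 0 := by
  induction p using MvPolynomial.induction_on' with
  | monomial u a =>
    rw [aeval_ite_monomial]
    by_cases hu : u = m
    · subst hu
      split_ifs <;> simp
    · split_ifs <;> simp [coeff_monomial, hu]
  | add p q hp hq =>
    rw [map_add, coeff_add, hp, hq, coeff_add]
    split_ifs <;> simp

theorem WeilA.lift_mk {n : ℕ} {B : Type*} [CommRing B] [Algebra ℝ B]
    (g : Fin n → B) (hg : ∀ i, g i ^ 2 = 0) (p : MvPolynomial (Fin n) ℝ) :
    WeilA.lift g hg (Ideal.Quotient.mk (weilIdeal n) p) = aeval g p :=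
  rfl

theorem epsAt_mk {n : ℕ} (j : Fin n) (p : MvPolynomial (Fin n) ℝ) :
    epsAt j (Ideal.Quotient.mk (weilIdeal n) p) = Ideal.Quotient.mk (weilIdeal n)
      (aeval (fun k => if k = j then 0 else X k : Fin n → MvPolynomial (Fin n) ℝ) p) := by
  rw [epsAt, WeilA.lift_mk, ← Ideal.Quotient.mkₐ_eq_mk ℝ, ← AlgHom.comp_apply, comp_aeval]
  congr 2
  ext k
  split_ifs <;> simp

theorem epsAll_mk {n : ℕ} (p : MvPolynomial (Fin n) ℝ) :
    epsAll (Ideal.Quotient.mk (weilIdeal n) p) =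
      Ideal.Quotient.mk (weilIdeal n) (C (coeff 0 p)) := by
  rw [epsAll, WeilA.lift_mk, aeval_zero', constantCoeff_eq]
  rfl

theorem prod_X_eq_monomial (n : ℕ) :
    (∏ i : Fin n, X i : MvPolynomial (Fin n) ℝ) =
      monomial (Finsupp.equivFunOnFinite.symm fun _ => 1) 1 := by
  rw [monomial_eq, Finsupp.prod_fintype _ _ (by simp)]
  simp

theorem coeff_C_add_C_mul_prod_X {n : ℕ} (a b : ℝ) (m : Fin n →₀ ℕ) :
    coeff m (C a + C b * ∏ i : Fin n, X i) =
      (if m = 0 then a else 0) + if ∀ i, m i = 1 then b else 0 := by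
  rw [prod_X_eq_monomial, coeff_add, coeff_C, coeff_C_mul, coeff_monomial]
  simp [eq_comm (a := (0 : Fin n →₀ ℕ)), Equiv.symm_apply_eq, funext_iff, eq_comm (a := 1)]

theorem mk_prod_X_sq {n : ℕ} (hn : 1 ≤ n) :
    Ideal.Quotient.mk (weilIdeal n) (∏ i : Fin n, X i) *
      Ideal.Quotient.mk (weilIdeal n) (∏ i : Fin n, X i) = 0 := by
  rw [← pow_two, map_prod, ← Finset.prod_pow]
  exact Finset.prod_eq_zero (Finset.mem_univ ⟨0, hn⟩) (WeilA.mk_X_sq n _)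

/-- The homomorphism `ℝ[ε] → A_n` sending `ε` to the product of the variables. -/
noncomputable def dualNumberToWeilA {n : ℕ} (hn : 1 ≤ n) : DualNumber ℝ →ₐ[ℝ] WeilA n :=
  DualNumber.lift ⟨(Algebra.ofId ℝ (WeilA n), Ideal.Quotient.mk (weilIdeal n) (∏ i, X i)),
    mk_prod_X_sq hn, fun _ => Commute.all _ _⟩

theorem dualNumberToWeilA_apply {n : ℕ} (hn : 1 ≤ n) (x : DualNumber ℝ) :
    dualNumberToWeilA hn x = Ideal.Quotient.mk (weilIdeal n)
      (C x.fst + C x.snd * ∏ i : Fin n, X i) := by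
  rw [dualNumberToWeilA, DualNumber.lift_apply_apply, map_add, map_mul]
  rfl

theorem dualNumberToWeilA_injective {n : ℕ} (hn : 1 ≤ n) :
    Function.Injective (dualNumberToWeilA hn) := by
  rw [injective_iff_map_eq_zero]
  intro x hx
  rw [dualNumberToWeilA_apply, Ideal.Quotient.eq_zero_iff_mem, mem_weilIdeal_iff] at hx
  simp only [coeff_C_add_C_mul_prod_X] at hx
  have : Nonempty (Fin n) := ⟨⟨0, hn⟩⟩
  have h₀ := hx 0 (by simp)
  have h₁ := hx (Finsupp.equivFunOnFinite.symm fun _ => 1) (by simp)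
  simp only [Finsupp.coe_zero, Pi.zero_apply, zero_ne_one, forall_const, if_true, if_false,
    add_zero] at h₀
  ext
  · exact h₀
  · simpa [h₀] using h₁

theorem epsAt_eq_epsAll_iff {n : ℕ} {p : MvPolynomial (Fin n) ℝ} :
    (∀ j, epsAt j (Ideal.Quotient.mk (weilIdeal n) p) =
        epsAll (Ideal.Quotient.mk (weilIdeal n) p)) ↔
      ∀ m : Fin n →₀ ℕ, (∀ i, m i ≤ 1) → m ≠ 0 → (∃ j, m j = 0) → coeff m p = 0 := by
  simp only [epsAt_mk, epsAll_mk, Ideal.Quotient.eq, mem_weilIdeal_iff, coeff_sub,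
    coeff_aeval_ite, coeff_C]
  constructor
  · rintro h m hm h₀ ⟨j, hj⟩
    simpa [hj, h₀.symm] using h j m hm
  · intro h j m hm
    by_cases h₀ : m = 0
    · simp [h₀]
    · by_cases hj : m j = 0
      · simp [hj, Ne.symm h₀, h m hm h₀ ⟨j, hj⟩]
      · simp [hj, Ne.symm h₀]

theorem range_dualNumberToWeilA {n : ℕ} (hn : 1 ≤ n) :
    Set.range (dualNumberToWeilA hn) = {q : WeilA n | ∀ j : Fin n, epsAt j q = epsAll q} := by
  ext q
  simp only [Set.mem_range, Set.mem_ofPred_eq]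
  constructor
  · rintro ⟨x, rfl⟩
    rw [dualNumberToWeilA_apply, epsAt_eq_epsAll_iff]
    rintro m - h₀ ⟨j, hj⟩
    rw [coeff_C_add_C_mul_prod_X, if_neg h₀, if_neg fun h => by simp [h j] at hj, add_zero]
  · obtain ⟨p, rfl⟩ := Ideal.Quotient.mk_surjective q
    rw [epsAt_eq_epsAll_iff]
    intro h
    refine ⟨TrivSqZeroExt.inl (coeff 0 p) +
      TrivSqZeroExt.inr (coeff (Finsupp.equivFunOnFinite.symm fun _ => 1) p), ?_⟩
    rw [dualNumberToWeilA_apply, Ideal.Quotient.eq, mem_weilIdeal_iff]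
    simp only [TrivSqZeroExt.fst_add, TrivSqZeroExt.snd_add, TrivSqZeroExt.fst_inl,
      TrivSqZeroExt.fst_inr, TrivSqZeroExt.snd_inl, TrivSqZeroExt.snd_inr, add_zero, zero_add]
    intro m hm
    rw [coeff_sub, coeff_C_add_C_mul_prod_X, sub_eq_zero]
    by_cases h₀ : m = 0
    · have : ¬ ∀ i, m i = 1 := fun h₁ => by simpa [h₀] using h₁ ⟨0, hn⟩
      rw [if_pos h₀, if_neg this, add_zero, h₀]
    · by_cases h₁ : ∀ i, m i = 1
      · obtain rfl : m = Finsupp.equivFunOnFinite.symm fun _ => 1 := Finsupp.ext h₁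
        rw [if_neg h₀, if_pos h₁, zero_add]
      · obtain ⟨j, hj⟩ := not_forall.1 h₁
        rw [if_neg h₀, if_neg h₁, add_zero, h m hm h₀ ⟨j, by have := hm j; omega⟩]

/-- The `ℝ`-algebra homomorphism `μ_n : ℝ[ε] → A_n` with `ε ↦ X₀⋯X_{n-1}` is well
defined and injective, and its range consists exactly of those `q` with
`ε_j q = ε_• q` for all `j`. -/
theorem dualNumber_to_weilA_injective_range (n : ℕ) (hn : 1 ≤ n) :
    ∃ μ : DualNumber ℝ →ₐ[ℝ] WeilA n,
      μ DualNumber.eps = Ideal.Quotient.mk (weilIdeal n) (∏ i : Fin n, X i) ∧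
      Function.Injective μ ∧
      Set.range μ = {q : WeilA n | ∀ j : Fin n, epsAt j q = epsAll q} := by
  exact ⟨dualNumberToWeilA hn, DualNumber.lift_apply_eps _, dualNumberToWeilA_injective hn,
    range_dualNumberToWeilA hn⟩
end

section
/- Let n ≥ 1, let E be a real vector space, and let φ ∈ E ⊗[ℝ] A_n be n-homogeneous, i.e. (id_E ⊗ s_i(α)) φ = α • φ for every i : Fin n and every α : ℝ. Then there exists a unique ω ∈ E with φ = ω ⊗ ∏X. -/
open MvPolynomial TensorProduct

set_option synthInstance.maxHeartbeats 400000 in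
/-- `s_i(α) : A_n →ₐ[ℝ] A_n`, induced by `X i ↦ α • X i` and `X k ↦ X k` for `k ≠ i`;
the algebraic form of scaling the `i`-th infinitesimal coordinate by `α`. -/
noncomputable def scaleAt {n : ℕ} (i : Fin n) (α : ℝ) : WeilA n →ₐ[ℝ] WeilA n :=
  WeilA.lift
    (fun k =>
      if k = i then α • Ideal.Quotient.mk (weilIdeal n) (X k)
      else Ideal.Quotient.mk (weilIdeal n) (X k))
    (by
      intro k
      by_cases h : k = i <;> simp [h, smul_pow, WeilA.mk_X_sq])

theorem coeff_equivFunOnFinite_one_eq_zero_of_mem_weilIdeal {n : ℕ}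
    {p : MvPolynomial (Fin n) ℝ} (hp : p ∈ weilIdeal n) :
    coeff (Finsupp.equivFunOnFinite.symm 1) p = 0 := by
  obtain ⟨f, rfl⟩ := (Submodule.mem_span_range_iff_exists_fun _).1 hp
  simp only [smul_eq_mul, coeff_sum, X_pow_eq_monomial, coeff_mul_monomial']
  refine Finset.sum_eq_zero fun i _ => if_neg ?_
  simp [Finsupp.single_le_iff]

/-- The coefficient of `∏ i, X i`, as a linear functional on `A_n`. -/
noncomputable def WeilA.topCoeff (n : ℕ) : WeilA n →ₗ[ℝ] ℝ :=
  Submodule.liftQ ((weilIdeal n).restrictScalars ℝ)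
    (lcoeff ℝ (Finsupp.equivFunOnFinite.symm 1 : Fin n →₀ ℕ))
    (fun _ hp => coeff_equivFunOnFinite_one_eq_zero_of_mem_weilIdeal hp) ∘ₗ
    (Submodule.Quotient.restrictScalarsEquiv ℝ (weilIdeal n)).symm.toLinearMap

theorem WeilA.topCoeff_mk {n : ℕ} (p : MvPolynomial (Fin n) ℝ) :
    WeilA.topCoeff n (Ideal.Quotient.mk (weilIdeal n) p) =
      coeff (Finsupp.equivFunOnFinite.symm 1) p := rfl

theorem prod_X_eq_monomial_one (n : ℕ) :
    (∏ i : Fin n, X i : MvPolynomial (Fin n) ℝ) =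
      monomial (Finsupp.equivFunOnFinite.symm 1) 1 := by
  rw [monomial_eq, Finsupp.prod_fintype _ _ (by simp)]
  simp

theorem WeilA.topCoeff_prod_X (n : ℕ) :
    WeilA.topCoeff n (Ideal.Quotient.mk (weilIdeal n) (∏ i : Fin n, X i)) = 1 := by
  rw [WeilA.topCoeff_mk, prod_X_eq_monomial_one, coeff_monomial, if_pos rfl]

theorem WeilA.mk_monomial_eq_topCoeff_smul {n : ℕ} (m : Fin n →₀ ℕ) (r : ℝ)
    (hm : ∀ i, m i ≠ 0) :
    Ideal.Quotient.mk (weilIdeal n) (monomial m r) =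
      WeilA.topCoeff n (Ideal.Quotient.mk (weilIdeal n) (monomial m r)) •
        Ideal.Quotient.mk (weilIdeal n) (∏ i : Fin n, X i) := by
  rw [WeilA.topCoeff_mk, coeff_monomial]
  split_ifs with h
  · rw [prod_X_eq_monomial_one, h, ← Ideal.Quotient.mkₐ_eq_mk ℝ, ← map_smul, smul_monomial,
      smul_eq_mul, mul_one]
  · obtain ⟨i, hi⟩ : ∃ i, m i ≠ 1 := by
      by_contra! hc
      exact h (Finsupp.ext hc)
    have h2 : Finsupp.single i 2 ≤ m := by
      rw [Finsupp.single_le_iff]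
      have := hm i
      omega
    rw [zero_smul, Ideal.Quotient.eq_zero_iff_mem, ← tsub_add_cancel_of_le h2,
      ← mul_one r, ← monomial_mul, ← X_pow_eq_monomial]
    exact Ideal.mul_mem_left _ _ (Ideal.subset_span ⟨i, rfl⟩)

theorem scaleAt_zero_mk_monomial {n : ℕ} (i : Fin n) (m : Fin n →₀ ℕ) (r : ℝ) :
    scaleAt i 0 (Ideal.Quotient.mk (weilIdeal n) (monomial m r)) =
      if m i = 0 then Ideal.Quotient.mk (weilIdeal n) (monomial m r) else 0 := by
  have key : scaleAt i 0 (Ideal.Quotient.mk (weilIdeal n) (monomial m r)) =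
      aeval (fun k => if k = i then (0 : ℝ) • Ideal.Quotient.mk (weilIdeal n) (X k)
        else Ideal.Quotient.mk (weilIdeal n) (X k)) (monomial m r) := rfl
  rw [key, aeval_monomial, Finsupp.prod_fintype _ _ (by simp)]
  split_ifs with h
  · rw [monomial_eq, Finsupp.prod_fintype _ _ (by simp), map_mul, map_prod]
    congr 1
    refine Finset.prod_congr rfl fun k _ => ?_
    by_cases hk : k = i
    · simp [hk, h]
    · simp [hk]
  · rw [Finset.prod_eq_zero (Finset.mem_univ i) (by simp [h]), mul_zero]

/-- The composite of the projections `1 - s_i(0)` over `i ∈ s` keeps exactly the monomials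
divisible by all `X i` with `i ∈ s`, and fixes the elements killed by every `s_i(0)`. -/
theorem exists_projection_fixing {n : ℕ} {E : Type*} [AddCommGroup E] [Module ℝ E]
    (φ : E ⊗[ℝ] WeilA n)
    (hφ : ∀ i : Fin n, LinearMap.lTensor E (scaleAt i 0).toLinearMap φ = 0)
    (s : Finset (Fin n)) :
    ∃ T : WeilA n →ₗ[ℝ] WeilA n, LinearMap.lTensor E T φ = φ ∧
      ∀ (m : Fin n →₀ ℕ) (r : ℝ), T (Ideal.Quotient.mk (weilIdeal n) (monomial m r)) =
        if ∀ i ∈ s, m i ≠ 0 then Ideal.Quotient.mk (weilIdeal n) (monomial m r) else 0 := by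
  induction s using Finset.induction_on with
  | empty => exact ⟨LinearMap.id, by simp, by simp⟩
  | insert i s _ ih =>
    obtain ⟨T, hT, hTm⟩ := ih
    refine ⟨T ∘ₗ (LinearMap.id - (scaleAt i 0).toLinearMap), ?_, fun m r => ?_⟩
    · rw [LinearMap.lTensor_comp, LinearMap.comp_apply, LinearMap.lTensor_sub,
        LinearMap.sub_apply, hφ, LinearMap.lTensor_id, LinearMap.id_apply, sub_zero, hT]
    · rw [LinearMap.comp_apply, LinearMap.sub_apply, LinearMap.id_apply,
        AlgHom.toLinearMap_apply, scaleAt_zero_mk_monomial]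
      by_cases h : m i = 0
      · simp [h]
      · simp only [if_false, sub_zero, hTm, Finset.forall_mem_insert, ne_eq, h,
          not_false_eq_true, true_and]

theorem lTensor_toSpanSingleton_comp {R E A : Type*} [CommRing R] [AddCommGroup E] [Module R E]
    [AddCommGroup A] [Module R A] (c : A →ₗ[R] R) (a : A) (φ : E ⊗[R] A) :
    LinearMap.lTensor E (LinearMap.toSpanSingleton R A a ∘ₗ c) φ =
      TensorProduct.rid R E (LinearMap.lTensor E c φ) ⊗ₜ[R] a := by
  induction φ with
  | zero => simp
  | tmul e b => simp [TensorProduct.smul_tmul]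
  | add x y hx hy => simp only [map_add, hx, hy, TensorProduct.add_tmul]

/-- The algebraic core of Theorem 5.2: an `n`-homogeneous element
`φ ∈ E ⊗ A_n` (i.e. `(id_E ⊗ s_i(α)) φ = α • φ` for all `i`, `α`) arises from a unique
`ω ∈ E` as `φ = ω ⊗ X₀⋯X_{n-1}`. -/
theorem lTensor_homogeneous_eq_tmul_prod_X (n : ℕ) (hn : 1 ≤ n)
    (E : Type*) [AddCommGroup E] [Module ℝ E] (φ : E ⊗[ℝ] WeilA n)
    (hφ : ∀ (i : Fin n) (α : ℝ),
      LinearMap.lTensor E (scaleAt i α).toLinearMap φ = α • φ) :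
    ∃! ω : E,
      φ = ω ⊗ₜ[ℝ] Ideal.Quotient.mk (weilIdeal n) (∏ i : Fin n, X i) := by
  obtain ⟨T, hT, hTm⟩ := exists_projection_fixing φ
    (fun i => by rw [hφ, zero_smul]) Finset.univ
  have hTc : T = LinearMap.toSpanSingleton ℝ (WeilA n)
      (Ideal.Quotient.mk (weilIdeal n) (∏ i : Fin n, X i)) ∘ₗ WeilA.topCoeff n := by
    refine LinearMap.ext fun a => ?_
    obtain ⟨p, rfl⟩ := Ideal.Quotient.mk_surjective a
    rw [p.as_sum]
    simp only [map_sum]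
    refine Finset.sum_congr rfl fun m _ => ?_
    rw [hTm, LinearMap.comp_apply, LinearMap.toSpanSingleton_apply]
    split_ifs with h
    · exact WeilA.mk_monomial_eq_topCoeff_smul m _ fun i => h i (Finset.mem_univ i)
    · rw [WeilA.topCoeff_mk, coeff_monomial, if_neg, zero_smul]
      rintro rfl
      simp at h
  refine ⟨TensorProduct.rid ℝ E (LinearMap.lTensor E (WeilA.topCoeff n) φ), ?_, ?_⟩
  · beta_reduce
    rw [← lTensor_toSpanSingleton_comp, ← hTc, hT]
  · rintro ω rfl
    rw [LinearMap.lTensor_tmul, WeilA.topCoeff_prod_X, TensorProduct.rid_tmul, one_smul]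
end

section
/- Let E be a real Banach space and f : ℝ → E a C^∞ map (ContDiff ℝ ⊤ f). Then there exists a C^∞ map g : ℝ → E such that f t = f 0 + t • deriv f 0 + t^2 • g t for every t : ℝ. -/
/-- Differentiation under the integral sign for weighted averages of a `C¹` curve along the
segments `[0, t]`. -/
theorem hasDerivAt_integral_pow_smul_comp_mul
    {E : Type*} [NormedAddCommGroup E] [NormedSpace ℝ E]
    {h : ℝ → E} (hh : ContDiff ℝ 1 h) (k : ℕ) (t : ℝ) :
    HasDerivAt (fun x : ℝ => ∫ s in (0 : ℝ)..1, s ^ k • h (s * x))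
      (∫ s in (0 : ℝ)..1, s ^ (k + 1) • deriv h (s * t)) t := by
  have hc : Continuous h := hh.continuous
  have hc' : Continuous (deriv h) := hh.continuous_deriv le_rfl
  obtain ⟨C, hC⟩ := (isCompact_closedBall (0 : ℝ) (|t| + 1)).exists_bound_of_continuousOn
    hc'.continuousOn
  refine (intervalIntegral.hasDerivAt_integral_of_dominated_loc_of_deriv_le
    (F := fun x s => s ^ k • h (s * x)) (F' := fun x s => s ^ (k + 1) • deriv h (s * x))
    (bound := fun _ => C) (Metric.ball_mem_nhds t one_pos)
    (.of_forall fun x => ?_) ?_ ?_ (.of_forall fun s hs x hx => ?_) ?_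
    (.of_forall fun s _ x _ => ?_)).2
  · exact (show Continuous fun s : ℝ => s ^ k • h (s * x) by fun_prop).aestronglyMeasurable
  · exact (show Continuous fun s : ℝ => s ^ k • h (s * t) by fun_prop).intervalIntegrable _ _
  · exact (show Continuous fun s : ℝ => s ^ (k + 1) • deriv h (s * t) by
      fun_prop).aestronglyMeasurable
  · rw [Set.uIoc_of_le zero_le_one] at hs
    have hs' : |s| ≤ 1 := abs_le.2 ⟨by linarith [hs.1], hs.2⟩
    have hx' : |x| ≤ |t| + 1 := by
      have h₁ : |x - t| < 1 := hx
      linarith [abs_sub_abs_le_abs_sub x t]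
    have hmem : s * x ∈ Metric.closedBall (0 : ℝ) (|t| + 1) := by
      rw [mem_closedBall_zero_iff, Real.norm_eq_abs, abs_mul]
      exact (mul_le_of_le_one_left (abs_nonneg x) hs').trans hx'
    rw [norm_smul, norm_pow, Real.norm_eq_abs]
    exact (mul_le_of_le_one_left (norm_nonneg _) (pow_le_one₀ (abs_nonneg s) hs')).trans
      (hC _ hmem)
  · exact intervalIntegrable_const
  · have hd : HasDerivAt h (deriv h (s * x)) (s * x) :=
      (hh.differentiable one_ne_zero _).hasDerivAt
    have hm : HasDerivAt (fun y : ℝ => s * y) s x := by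
      simpa using (hasDerivAt_id x).const_mul s
    rw [pow_succ, mul_smul]
    exact (hd.scomp x hm).const_smul (s ^ k)

/-- Weighted averages along the segments `[0, t]` of a smooth curve depend smoothly on `t`. -/
theorem contDiff_integral_pow_smul_comp_mul
    {E : Type*} [NormedAddCommGroup E] [NormedSpace ℝ E]
    {h : ℝ → E} (hh : ContDiff ℝ (⊤ : ℕ∞) h) (k : ℕ) :
    ContDiff ℝ (⊤ : ℕ∞) (fun x : ℝ => ∫ s in (0 : ℝ)..1, s ^ k • h (s * x)) := by
  refine contDiff_infty.2 fun n => ?_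
  induction n generalizing h k with
  | zero =>
    exact contDiff_zero.2 <| continuous_iff_continuousAt.2 fun t =>
      (hasDerivAt_integral_pow_smul_comp_mul (hh.of_le (by simp)) k t).continuousAt
  | succ n ih =>
    have hd := hasDerivAt_integral_pow_smul_comp_mul (hh.of_le (by simp)) k
    push_cast
    refine contDiff_succ_iff_deriv.2 ⟨fun t => (hd t).differentiableAt, by simp, ?_⟩
    rw [funext fun t => (hd t).deriv]
    exact ih (contDiff_infty_iff_deriv.1 hh).2 (k + 1)

/-- Hadamard's lemma: a smooth curve `f` in a Banach space satisfies `f t = f 0 + t • g t`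
with `g` smooth and `g 0 = f'(0)`. -/
theorem exists_smooth_first_order_remainder
    {E : Type*} [NormedAddCommGroup E] [NormedSpace ℝ E] [CompleteSpace E]
    {f : ℝ → E} (hf : ContDiff ℝ (⊤ : ℕ∞) f) :
    ∃ g : ℝ → E, ContDiff ℝ (⊤ : ℕ∞) g ∧ g 0 = deriv f 0 ∧ ∀ t : ℝ, f t = f 0 + t • g t := by
  have hf' : ContDiff ℝ (⊤ : ℕ∞) (deriv f) := (contDiff_infty_iff_deriv.1 hf).2
  refine ⟨fun t => ∫ s in (0 : ℝ)..1, deriv f (s * t),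
    by simpa using contDiff_integral_pow_smul_comp_mul hf' 0, by simp, fun t => ?_⟩
  have hI : ∫ x in (0 : ℝ)..t, deriv f x = f t - f 0 :=
    intervalIntegral.integral_deriv_eq_sub (fun x _ => hf.differentiable (by simp) x)
      (hf'.continuous.intervalIntegrable _ _)
  simp [intervalIntegral.smul_integral_comp_mul_right, hI]

/-- Second-order Hadamard lemma: a smooth curve `f : ℝ → E` in a real Banach space
admits a smooth remainder `g` with `f t = f 0 + t • f'(0) + t² • g t`. -/
theorem exists_smooth_second_order_remainder
    {E : Type*} [NormedAddCommGroup E] [NormedSpace ℝ E] [CompleteSpace E]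
    (f : ℝ → E) (hf : ContDiff ℝ (⊤ : ℕ∞) f) :
    ∃ g : ℝ → E, ContDiff ℝ (⊤ : ℕ∞) g ∧
      ∀ t : ℝ, f t = f 0 + t • deriv f 0 + t ^ 2 • g t := by
  obtain ⟨φ, hφ, hφ0, hfφ⟩ := exists_smooth_first_order_remainder hf
  obtain ⟨g, hg, -, hφg⟩ := exists_smooth_first_order_remainder hφ
  refine ⟨g, hg, fun t => ?_⟩
  rw [hfφ t, hφg t, hφ0, smul_add, smul_smul, ← pow_two, add_assoc]
end

section
/- For natural numbers m, n, k and simplicial data p : Finset (Finset (Fin m)), q : Finset (Finset (Fin n)), r : Finset (Finset (Fin k)), one has the associativity law: the image of (p ⊕ q) ⊕ r under the map on Finset (Finset (Fin ((m+n)+k))) induced by the canonical equivalence Fin ((m+n)+k) ≃ Fin (m+(n+k)) (finCongr of add_assoc) equals p ⊕ (q ⊕ r). -/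
/-- The sum `p ⊕ q` of two simplicial data: it consists of the members of `p`
(transported along `Fin.castAdd n`), the members of `q` (transported along
`Fin.natAdd m`), and all the mixed pairs `{castAdd n i, natAdd m j}`.
It encodes the simplicial infinitesimal object `D^m{p} ⊕ D^n{q} = D^{m+n}{p ⊕ q}`. -/
def simplicialSum {m n : ℕ} (p : Finset (Finset (Fin m))) (q : Finset (Finset (Fin n))) :
    Finset (Finset (Fin (m + n))) :=
  p.image (fun S => S.image (Fin.castAdd n)) ∪
    q.image (fun S => S.image (Fin.natAdd m)) ∪
    (Finset.univ : Finset (Fin m × Fin n)).image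
      (fun ij => {Fin.castAdd n ij.1, Fin.natAdd m ij.2})

theorem mem_simplicialSum {m n : ℕ} {p : Finset (Finset (Fin m))} {q : Finset (Finset (Fin n))}
    {S : Finset (Fin (m + n))} :
    S ∈ simplicialSum p q ↔
      (∃ A ∈ p, A.image (Fin.castAdd n) = S) ∨ (∃ B ∈ q, B.image (Fin.natAdd m) = S) ∨
        ∃ i j, {Fin.castAdd n i, Fin.natAdd m j} = S := by
  simp [simplicialSum]

theorem exists_mem_simplicialSum {m n : ℕ} {p : Finset (Finset (Fin m))}
    {q : Finset (Finset (Fin n))} {P : Finset (Fin (m + n)) → Prop} :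
    (∃ S ∈ simplicialSum p q, P S) ↔
      (∃ A ∈ p, P (A.image (Fin.castAdd n))) ∨ (∃ B ∈ q, P (B.image (Fin.natAdd m))) ∨
        ∃ i j, P {Fin.castAdd n i, Fin.natAdd m j} := by
  simp only [mem_simplicialSum]
  constructor
  · rintro ⟨_, ⟨A, hA, rfl⟩ | ⟨B, hB, rfl⟩ | ⟨i, j, rfl⟩, h⟩
    exacts [.inl ⟨A, hA, h⟩, .inr (.inl ⟨B, hB, h⟩), .inr (.inr ⟨i, j, h⟩)]
  · rintro (⟨A, hA, h⟩ | ⟨B, hB, h⟩ | ⟨i, j, h⟩)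
    exacts [⟨_, .inl ⟨A, hA, rfl⟩, h⟩, ⟨_, .inr (.inl ⟨B, hB, rfl⟩), h⟩,
      ⟨_, .inr (.inr ⟨i, j, rfl⟩), h⟩]

theorem Fin.exists_fin_add {m n : ℕ} {P : Fin (m + n) → Prop} :
    (∃ i, P i) ↔ (∃ i, P (Fin.castAdd n i)) ∨ ∃ j, P (Fin.natAdd m j) := by
  constructor
  · rintro ⟨i, hi⟩
    induction i using Fin.addCases with
    | left i => exact .inl ⟨i, hi⟩
    | right j => exact .inr ⟨j, hi⟩
  · rintro (⟨i, hi⟩ | ⟨j, hj⟩)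
    exacts [⟨_, hi⟩, ⟨_, hj⟩]

/-- Associativity of the sum of simplicial data: `(p ⊕ q) ⊕ r = p ⊕ (q ⊕ r)` up to the
canonical identification `Fin ((m+n)+k) ≃ Fin (m+(n+k))`. -/
theorem simplicialSum_assoc (m n k : ℕ)
    (p : Finset (Finset (Fin m))) (q : Finset (Finset (Fin n)))
    (r : Finset (Finset (Fin k))) :
    (simplicialSum (simplicialSum p q) r).image
        (fun S => S.image (finCongr (add_assoc m n k))) =
      simplicialSum p (simplicialSum q r) := by
  have hl (i : Fin m) : finCongr (add_assoc m n k) (Fin.castAdd k (Fin.castAdd n i)) =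
      Fin.castAdd (n + k) i := rfl
  have hm (i : Fin n) : finCongr (add_assoc m n k) (Fin.castAdd k (Fin.natAdd m i)) =
      Fin.natAdd m (Fin.castAdd k i) := rfl
  have hr (i : Fin k) : finCongr (add_assoc m n k) (Fin.natAdd (m + n) i) =
      Fin.natAdd m (Fin.natAdd n i) := Fin.ext (add_assoc m n i)
  ext S
  rw [Finset.mem_image, exists_mem_simplicialSum, mem_simplicialSum]
  simp only [exists_mem_simplicialSum, Fin.exists_fin_add, exists_or, Finset.image_image,
    Finset.image_insert, Finset.image_singleton, Function.comp_def, hl, hm, hr]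
  eta_reduce
  rw [iff_iff_eq]
  ac_rfl
end
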